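/- arXiv:0811.4450 — 4 statements merged into one kernel-verified Lean document; each statement's English description precedes it below -/
import Mathlib

section
/- Let p, r, m, d be positive real numbers with r·m·p + d·(r − d) > 0 (saddle regime), let b, k be real, and set s = √(r² + 4·r·m·p), D = d·(r − d) + r·m·p, L* = (k·p − b·(r − d))/D, F* = (k·d + r·m·b)/D. Suppose a state (L, F) ∈ ℝ² satisfies (L − L*, F − F*) = c₁·(2p, r + s) + c₂·(2p, r − s) with c₁ ≥ 0, c₂ ≤ 0, and (c₁, c₂) ≠ (0, 0). Then m·(p·F − d·L − b) + (r·(m·L + F) − d·F − k) > 0; that is, a p-type organization always experiences a strict increase in strength S = m·L + F. -/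
/-- A p-type organization (displacement from the fixed point with `c₁ ≥ 0`
along `v₊`, `c₂ ≤ 0` along `v₋`, not both zero) always experiences a strict
increase in strength `S = m·L + F`: the time-derivative
`m·(p·F − d·L − b) + (r·(m·L + F) − d·F − k)` is strictly positive. -/
theorem ptype_strength_increases (p r m d b k : ℝ)
    (hp : 0 < p) (hr : 0 < r) (hm : 0 < m) (hd : 0 < d)
    (hsaddle : r * m * p + d * (r - d) > 0)
    (s D Lstar Fstar : ℝ)
    (hs : s = Real.sqrt (r ^ 2 + 4 * r * m * p))
    (hD : D = d * (r - d) + r * m * p)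
    (hL : Lstar = (k * p - b * (r - d)) / D)
    (hF : Fstar = (k * d + r * m * b) / D)
    (L F c₁ c₂ : ℝ)
    (hc₁ : 0 ≤ c₁) (hc₂ : c₂ ≤ 0) (hne : (c₁, c₂) ≠ (0, 0))
    (hdecomp : (L - Lstar, F - Fstar)
        = (c₁ * (2 * p) + c₂ * (2 * p), c₁ * (r + s) + c₂ * (r - s))) :
    m * (p * F - d * L - b) + (r * (m * L + F) - d * F - k) > 0 := by
  have hrmp : 0 < r * m * p := by positivity
  have hpm : 0 < p * m := by positivity
  have hs_sq : s ^ 2 = r ^ 2 + 4 * r * m * p := by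
    rw [hs, Real.sq_sqrt (by positivity)]
  have hs_pos : 0 < s := by rw [hs]; exact Real.sqrt_pos.mpr (by positivity)
  have hD_ne : D ≠ 0 := by rw [hD]; linarith
  -- the eigenvalues are `((r - 2 * d) ± s) / 2`, and their product is `-D < 0`
  have habs : |r - 2 * d| < s := abs_lt_of_sq_lt_sq (by nlinarith) hs_pos.le
  obtain ⟨hunstable, hstable⟩ := abs_lt.mp habs
  -- the strengths of `v₊` and `v₋` are both positive
  have hstrength : s < 2 * p * m + r := by
    refine lt_of_pow_lt_pow_left₀ 2 (by positivity) ?_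
    nlinarith [sq_pos_of_pos hpm]
  have hfix_L : p * Fstar - d * Lstar = b := by
    rw [hL, hF]; field_simp; rw [hD]; ring
  have hfix_F : r * (m * Lstar + Fstar) - d * Fstar = k := by
    rw [hL, hF]; field_simp; rw [hD]; ring
  obtain ⟨hdL, hdF⟩ := Prod.mk.inj hdecomp
  have hderiv : m * (p * F - d * L - b) + (r * (m * L + F) - d * F - k)
      = c₁ * ((r - 2 * d + s) / 2 * (2 * p * m + r + s))
        + -c₂ * ((s - (r - 2 * d)) / 2 * (2 * p * m + r - s)) := by
    linear_combination (r * m - m * d) * hdL + (m * p + r - d) * hdF + m * hfix_L + hfix_F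
      - (c₁ + c₂) / 2 * hs_sq
  have hplus : 0 < (r - 2 * d + s) / 2 * (2 * p * m + r + s) :=
    mul_pos (by linarith) (by linarith)
  have hminus : 0 < (s - (r - 2 * d)) / 2 * (2 * p * m + r - s) :=
    mul_pos (by linarith) (by linarith)
  rw [hderiv]
  rcases hc₁.eq_or_lt with h | h
  · have hc₂_ne : c₂ ≠ 0 := fun h₂ => hne (by rw [← h, h₂])
    have hc₂_neg : 0 < -c₂ := neg_pos.mpr (lt_of_le_of_ne hc₂ hc₂_ne)
    exact add_pos_of_nonneg_of_pos (mul_nonneg hc₁ hplus.le) (mul_pos hc₂_neg hminus)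
  · exact add_pos_of_pos_of_nonneg (mul_pos h hplus)
      (mul_nonneg (neg_nonneg.mpr hc₂) hminus.le)
end

section
/- Let p, r, m, d be positive real numbers with r·m·p + d·(r − d) > 0 (saddle regime), let b, k be real, and set s = √(r² + 4·r·m·p), D = d·(r − d) + r·m·p, L* = (k·p − b·(r − d))/D, F* = (k·d + r·m·b)/D. Suppose a state (L, F) ∈ ℝ² satisfies (L − L*, F − F*) = c₁·(2p, r + s) + c₂·(2p, r − s) with c₁ ≥ 0, c₂ ≥ 0, and (c₁, c₂) ≠ (0, 0). Then r·(m·L + F) − d·F − k > 0; that is, an r-type organization always experiences a strict increase in its pool of foot soldiers F. -/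
/-- An r-type organization (displacement from the fixed point with `c₁ ≥ 0`
along `v₊`, `c₂ ≥ 0` along `v₋`, not both zero) always experiences a strict
increase in its pool of foot soldiers `F`: the time-derivative
`r·(m·L + F) − d·F − k` is strictly positive. -/
theorem rtype_footsoldiers_increase (p r m d b k : ℝ)
    (hp : 0 < p) (hr : 0 < r) (hm : 0 < m) (hd : 0 < d)
    (hsaddle : r * m * p + d * (r - d) > 0)
    (s D Lstar Fstar : ℝ)
    (hs : s = Real.sqrt (r ^ 2 + 4 * r * m * p))
    (hD : D = d * (r - d) + r * m * p)
    (hL : Lstar = (k * p - b * (r - d)) / D)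
    (hF : Fstar = (k * d + r * m * b) / D)
    (L F c₁ c₂ : ℝ)
    (hc₁ : 0 ≤ c₁) (hc₂ : 0 ≤ c₂) (hne : (c₁, c₂) ≠ (0, 0))
    (hdecomp : (L - Lstar, F - Fstar)
        = (c₁ * (2 * p) + c₂ * (2 * p), c₁ * (r + s) + c₂ * (r - s))) :
    r * (m * L + F) - d * F - k > 0 := by
  have hrmp : 0 < r * m * p := by positivity
  have hs_sq : s ^ 2 = r ^ 2 + 4 * r * m * p := by
    rw [hs, Real.sq_sqrt (by positivity)]
  have hs_nonneg : 0 ≤ s := hs ▸ Real.sqrt_nonneg _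
  have hrs : r < s := by nlinarith
  have hD_pos : 0 < D := by linarith
  have hfix : r * (m * Lstar + Fstar) - d * Fstar - k = 0 := by
    rw [hL, hF]
    field_simp
    rw [hD]
    ring
  have hunstable : 0 < (r + s) / 2 - d := by
    refine pos_of_mul_pos_left (b := (s - r) / 2 + d) ?_ (by linarith)
    linear_combination hsaddle - hs_sq / 4
  have hplus : 0 < (r + s) * ((r + s) / 2 - d) := mul_pos (by linarith) hunstable
  have hminus : 0 < (r - s) * ((r - s) / 2 - d) :=
    mul_pos_of_neg_of_neg (by linarith) (by linarith)
  obtain ⟨hdL, hdF⟩ := Prod.mk.inj hdecomp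
  have hderiv : r * (m * L + F) - d * F - k
      = c₁ * ((r + s) * ((r + s) / 2 - d)) + c₂ * ((r - s) * ((r - s) / 2 - d)) := by
    linear_combination hfix + r * m * hdL + (r - d) * hdF - (c₁ + c₂) / 2 * hs_sq
  rw [hderiv]
  rcases hc₁.eq_or_lt with h₁ | h₁
  · have h₂ : 0 < c₂ := hc₂.lt_of_ne fun h₂ => hne (by rw [← h₁, ← h₂])
    exact add_pos_of_nonneg_of_pos (mul_nonneg hc₁ hplus.le) (mul_pos h₂ hminus)
  · exact add_pos_of_pos_of_nonneg (mul_pos h₁ hplus) (mul_nonneg hc₂ hminus.le)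
end

section
/- Let p, r, m, d be positive real numbers with r·m·p + d·(r − d) > 0 (saddle regime), let b, k be real, and set s = √(r² + 4·r·m·p), D = d·(r − d) + r·m·p, L* = (k·p − b·(r − d))/D, F* = (k·d + r·m·b)/D. Suppose a state (L, F) ∈ ℝ² satisfies (L − L*, F − F*) = c₁·(2p, r + s) + c₂·(2p, r − s), and suppose both m·(p·F − d·L − b) + (r·(m·L + F) − d·F − k) < 0 and r·(m·L + F) − d·F − k < 0 (i.e., both the strength S and the pool of foot soldiers F are declining at this state). Then c₁ < 0; that is, the organization lies in the region of defeated organizations below the sink line. -/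
/-- Main theorem: if at a state `(L, F)` both the strength `S = m·L + F` and
the pool of foot soldiers `F` are strictly declining, then the coefficient
`c₁` of the displacement from the fixed point along the unstable eigenvector
`v₊` is negative: the organization lies in the region of defeated
organizations below the sink line. -/
theorem decline_in_S_and_F_implies_defeat (p r m d b k : ℝ)
    (hp : 0 < p) (hr : 0 < r) (hm : 0 < m) (hd : 0 < d)
    (hsaddle : r * m * p + d * (r - d) > 0)
    (s D Lstar Fstar : ℝ)
    (hs : s = Real.sqrt (r ^ 2 + 4 * r * m * p))
    (hD : D = d * (r - d) + r * m * p)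
    (hL : Lstar = (k * p - b * (r - d)) / D)
    (hF : Fstar = (k * d + r * m * b) / D)
    (L F c₁ c₂ : ℝ)
    (hdecomp : (L - Lstar, F - Fstar)
        = (c₁ * (2 * p) + c₂ * (2 * p), c₁ * (r + s) + c₂ * (r - s)))
    (hSdecl : m * (p * F - d * L - b) + (r * (m * L + F) - d * F - k) < 0)
    (hFdecl : r * (m * L + F) - d * F - k < 0) :
    c₁ < 0 := by
  have hDpos : 0 < D := by rw [hD]; linarith
  have hrmp : 0 < r * m * p := by positivity
  have hmp : 0 < m * p := by positivity
  have hs_sq : s ^ 2 = r ^ 2 + 4 * r * m * p := by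
    rw [hs, Real.sq_sqrt (by nlinarith [sq_nonneg r])]
  have hs_nonneg : 0 ≤ s := hs ▸ Real.sqrt_nonneg _
  have hrs : r < s := by nlinarith
  have hs_lt : s < r + 2 * (m * p) := by nlinarith [sq_pos_of_pos hmp]
  have hLD : Lstar * D = k * p - b * (r - d) := by rw [hL]; field_simp
  have hFD : Fstar * D = k * d + r * m * b := by rw [hF]; field_simp
  have hfixL : p * Fstar - d * Lstar - b = 0 := by
    refine (mul_eq_zero.mp ?_).resolve_right hDpos.ne'
    linear_combination p * hFD - d * hLD - b * hD
  have hfixF : r * (m * Lstar + Fstar) - d * Fstar - k = 0 := by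
    refine (mul_eq_zero.mp ?_).resolve_right hDpos.ne'
    linear_combination r * m * hLD + (r - d) * hFD - k * hD
  obtain ⟨hx, hy⟩ := Prod.mk.inj hdecomp
  -- Twice the eigenvalues are `r + s - 2 * d` and `r - s - 2 * d`.
  have hunstable : 0 < r + s - 2 * d := by nlinarith
  have hstable : r - s - 2 * d < 0 := by linarith
  have hFdot : 2 * (r * (m * L + F) - d * F - k)
      = c₁ * ((r + s - 2 * d) * (r + s)) + c₂ * ((r - s - 2 * d) * (r - s)) := by
    linear_combination 2 * hfixF + 2 * r * m * hx + 2 * (r - d) * hy - (c₁ + c₂) * hs_sq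
  have hLdot : 2 * (p * F - d * L - b)
      = c₁ * ((r + s - 2 * d) * (2 * p)) + c₂ * ((r - s - 2 * d) * (2 * p)) := by
    linear_combination 2 * hfixL + 2 * p * hy - 2 * d * hx
  by_contra! hc₁
  have hF₁ : 0 ≤ c₁ * ((r + s - 2 * d) * (r + s)) := by positivity
  have hF₂ : 0 < (r - s - 2 * d) * (r - s) :=
    mul_pos_of_neg_of_neg hstable (by linarith)
  have hc₂ : c₂ < 0 := by
    by_contra! h
    linarith [mul_nonneg h hF₂.le]
  have hS₁ : 0 ≤ c₁ * ((r + s - 2 * d) * (r + s + 2 * (m * p))) := by positivity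
  have hS₂ : 0 < c₂ * (r - s - 2 * d) * (r - s + 2 * (m * p)) :=
    mul_pos (mul_pos_of_neg_of_neg hc₂ hstable) (by linarith)
  linarith [congrArg (m * ·) hLdot]
end

section
/- Let p, r, m, d be positive real numbers with r·m·p + d·(r − d) > 0, let b, k be real, and set s = √(r² + 4·r·m·p), λ₊ = (r − 2d + s)/2, λ₋ = (r − 2d − s)/2, D = d·(r − d) + r·m·p, L* = (k·p − b·(r − d))/D, F* = (k·d + r·m·b)/D. Fix constants c₁ ≠ 0 and c₂ ∈ ℝ, and define the solution L(t) = L* + c₁·e^{λ₊·t}·2p + c₂·e^{λ₋·t}·2p, F(t) = F* + c₁·e^{λ₊·t}·(r + s) + c₂·e^{λ₋·t}·(r − s). Then the ratio (F(t) − F*)/(L(t) − L*) tends to (r + √(r² + 4·r·m·p))/(2p) as t → ∞; that is, the long-term ratio of foot soldiers to leaders (measured from the fixed point) equals the slope of the trend line, and depends only on the growth parameters r, m, p. -/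
open Filter

/-- For any non-neutralized-or-growing solution with `c₁ ≠ 0`, the ratio
`(F(t) − F*)/(L(t) − L*)` tends to the trend-line slope
`(r + √(r² + 4·r·m·p))/(2p)` as `t → ∞`: the long-term ratio of foot
soldiers to leaders depends only on the growth parameters `r, m, p`. -/
theorem longterm_ratio_tends_to_trend_slope (p r m d b k : ℝ)
    (hp : 0 < p) (hr : 0 < r) (hm : 0 < m) (hd : 0 < d)
    (hsaddle : r * m * p + d * (r - d) > 0)
    (s lamp lamm D Lstar Fstar : ℝ)
    (hs : s = Real.sqrt (r ^ 2 + 4 * r * m * p))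
    (hlp : lamp = (r - 2 * d + s) / 2)
    (hlm : lamm = (r - 2 * d - s) / 2)
    (hDdef : D = d * (r - d) + r * m * p)
    (hL : Lstar = (k * p - b * (r - d)) / D)
    (hF : Fstar = (k * d + r * m * b) / D)
    (c₁ c₂ : ℝ) (hc₁ : c₁ ≠ 0)
    (L F : ℝ → ℝ)
    (hLdef : L = fun t => Lstar + c₁ * Real.exp (lamp * t) * (2 * p)
                        + c₂ * Real.exp (lamm * t) * (2 * p))
    (hFdef : F = fun t => Fstar + c₁ * Real.exp (lamp * t) * (r + s)
                        + c₂ * Real.exp (lamm * t) * (r - s)) :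
    Tendsto (fun t => (F t - Fstar) / (L t - Lstar)) atTop
      (nhds ((r + Real.sqrt (r ^ 2 + 4 * r * m * p)) / (2 * p))) := by
  have hs_pos : 0 < s := hs ▸ Real.sqrt_pos.mpr (by positivity)
  have hdecay : Tendsto (fun t : ℝ => Real.exp (-(s * t))) atTop (nhds 0) :=
    Real.tendsto_exp_neg_atTop_nhds_zero.comp (tendsto_id.const_mul_atTop hs_pos)
  have hexp (t : ℝ) :
      Real.exp (lamm * t) = Real.exp (lamp * t) * Real.exp (-(s * t)) := by
    rw [← Real.exp_add, hlm, hlp]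
    congr 1
    ring
  have hratio (t : ℝ) : (F t - Fstar) / (L t - Lstar) =
      (c₁ * (r + s) + c₂ * (r - s) * Real.exp (-(s * t))) /
        (c₁ * (2 * p) + c₂ * (2 * p) * Real.exp (-(s * t))) := by
    rw [← mul_div_mul_left (c₁ * (r + s) + _) _ (Real.exp_ne_zero (lamp * t)), hFdef, hLdef]
    simp only [hexp]
    congr 1 <;> ring
  have hlim := ((hdecay.const_mul (c₂ * (r - s))).const_add (c₁ * (r + s))).div
    ((hdecay.const_mul (c₂ * (2 * p))).const_add (c₁ * (2 * p)))
    (by simp [hc₁, hp.ne'])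
  rw [mul_zero, mul_zero, add_zero, add_zero, mul_div_mul_left _ _ hc₁] at hlim
  rw [← hs]
  exact hlim.congr fun t => (hratio t).symm
end
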